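/- There exists a constant C > 0 such that for every γ > 1 and every δ, ε with 0 < δ < 1/2 and 0 < ε < 1/2, there is a real polynomial P of degree at most C·(γ/δ)·log(γ/ε) satisfying: (i) |P(x)| ≤ 1 for all x ∈ [−1, 1], and (ii) |P(x) − γ·x| ≤ ε·γ·x for all x ∈ [0, (1−δ)/γ]. (This is the polynomial underlying uniform singular value amplification: applying it to a block encoding via QSVT yields a block encoding of γ·A with relative accuracy ε on singular values in [0, (1−δ)/γ], using O((γ/δ)·log(γ/ε)) applications of the original block encoding.) -/

import Mathlib

lemma aux_cos_upper {y : ℝ} (h0 : 0 ≤ y) (h1 : y ≤ Real.pi) :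
    2 / Real.pi ^ 2 * y ^ 2 ≤ 1 - Real.cos y := by
  have h := Real.mul_le_sin (x := y / 2) (by linarith) (by linarith)
  have h2 : Real.cos y = 1 - 2 * Real.sin (y / 2) ^ 2 := by
    have := Real.cos_two_mul (y / 2)
    have h3 := Real.sin_sq_add_cos_sq (y / 2)
    rw [show 2 * (y / 2) = y by ring] at this
    linarith
  have hp := Real.pi_pos
  have h4 : (2 / Real.pi * (y / 2)) ^ 2 ≤ Real.sin (y / 2) ^ 2 := by
    gcongr
  have h5 : (2 / Real.pi * (y / 2)) ^ 2 = 1 / Real.pi ^ 2 * y ^ 2 := by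
    field_simp
  have h6 : 2 / Real.pi ^ 2 * y ^ 2 = 2 * (1 / Real.pi ^ 2 * y ^ 2) := by ring
  rw [h6, h2]
  linarith

lemma aux_fejer (n : ℕ) (hn : 1 ≤ n) : ∃ g : Polynomial ℝ, g.natDegree ≤ n ∧
    (∀ v : ℝ, 0 < v → v ≤ 2 → 0 ≤ g.eval v) ∧
    (∀ v : ℝ, 0 < v → v ≤ 2 → g.eval v ≤ 2 / v) ∧
    (∀ v : ℝ, 0 ≤ v → v ≤ 2 / (n : ℝ) ^ 2 → 2 / 5 * (n : ℝ) ^ 2 ≤ g.eval v) := by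
  have hn' : (1 : ℝ) ≤ n := by exact_mod_cast hn
  set A : Polynomial ℝ := 1 - (Polynomial.Chebyshev.T ℝ n).comp (1 - Polynomial.X) with hA
  have hA0 : A.eval 0 = 0 := by simp [hA]
  have hdeg : A.natDegree ≤ n := by
    refine (Polynomial.natDegree_sub_le _ _).trans (max_le (by simp) ?_)
    refine Polynomial.natDegree_comp_le.trans ?_
    rw [Polynomial.Chebyshev.natDegree_T]
    have : (1 - Polynomial.X : Polynomial ℝ).natDegree ≤ 1 :=
      (Polynomial.natDegree_sub_le _ _).trans (by simp)
    simpa using Nat.mul_le_mul_left n this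
  obtain ⟨g, hg⟩ : Polynomial.X ∣ A :=
    Polynomial.X_dvd_iff.2 (by rwa [Polynomial.coeff_zero_eq_eval_zero])
  have hev : ∀ v : ℝ, v * g.eval v = 1 - (Polynomial.Chebyshev.T ℝ n).eval (1 - v) := by
    intro v
    have := congrArg (Polynomial.eval v) hg
    simpa [hA] using this.symm
  have hpos : ∀ v : ℝ, 0 < v → v ≤ 2 → 0 ≤ v * g.eval v ∧ v * g.eval v ≤ 2 := by
    intro v h0 h2
    have := abs_le.1 (Polynomial.Chebyshev.abs_eval_T_real_le_one n (x := 1 - v)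
      (abs_le.2 ⟨by linarith, by linarith⟩))
    rw [hev]; constructor <;> linarith [this.1, this.2]
  have hlow : ∀ v : ℝ, 0 < v → v ≤ 2 / (n : ℝ) ^ 2 → 2 / 5 * (n : ℝ) ^ 2 ≤ g.eval v := by
    intro v h0 h1
    have hp := Real.pi_pos
    have hn2 : 2 / (n : ℝ) ^ 2 ≤ 2 := div_le_self (by norm_num) (one_le_pow₀ hn')
    have hcos : Real.cos (Real.arccos (1 - v)) = 1 - v :=
      Real.cos_arccos (by linarith) (by linarith)
    set φ := Real.arccos (1 - v)
    have hφ0 : 0 ≤ φ := Real.arccos_nonneg _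
    have hφ1 : φ ≤ Real.pi := Real.arccos_le_pi _
    have h3 := aux_cos_upper hφ0 hφ1
    rw [hcos] at h3
    have h4 : (n * φ) ^ 2 ≤ Real.pi ^ 2 := by
      have : 2 / Real.pi ^ 2 * φ ^ 2 ≤ 2 / (n : ℝ) ^ 2 := by linarith
      rw [div_mul_eq_mul_div, div_le_div_iff₀ (by positivity) (by positivity)] at this
      nlinarith
    have h5 : n * φ ≤ Real.pi := (abs_le.1 (abs_le_of_sq_le_sq h4 hp.le)).2
    have h6 := aux_cos_upper (by positivity) h5
    have h7 : 1 - φ ^ 2 / 2 ≤ Real.cos φ := Real.one_sub_sq_div_two_le_cos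
    rw [hcos] at h7
    have h8 : v * g.eval v = 1 - Real.cos (n * φ) := by
      rw [hev, ← hcos, Polynomial.Chebyshev.T_real_cos]; simp
    rw [← h8] at h6
    have hpi : Real.pi ^ 2 ≤ 10 := by nlinarith [Real.pi_lt_d2]
    have h9 : 2 / 10 * (n * φ) ^ 2 ≤ 2 / Real.pi ^ 2 * (n * φ) ^ 2 := by gcongr
    have h10 : v * (2 / 5 * (n : ℝ) ^ 2) ≤ v * g.eval v := by
      have : (n : ℝ) ^ 2 * (2 * v) ≤ n ^ 2 * φ ^ 2 := by gcongr; linarith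
      nlinarith
    exact le_of_mul_le_mul_left h10 h0
  refine ⟨g, ?_, ?_, ?_, ?_⟩
  · by_cases hg0 : g = 0
    · simp [hg0]
    · rw [hg, Polynomial.natDegree_X_mul hg0] at hdeg
      omega
  · intro v h0 h2
    exact nonneg_of_mul_nonneg_right (hpos v h0 h2).1 h0
  · intro v h0 h2
    rw [le_div_iff₀ h0, mul_comm]; exact (hpos v h0 h2).2
  · intro v h0 h1
    rcases h0.eq_or_lt with h | h
    · subst h
      have hc : IsClosed {v : ℝ | 2 / 5 * (n : ℝ) ^ 2 ≤ g.eval v} :=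
        isClosed_le continuous_const g.continuous
      have hb : (0 : ℝ) < 2 / (n : ℝ) ^ 2 := by positivity
      have hsub : Set.Ioo 0 (2 / (n : ℝ) ^ 2) ⊆ {v : ℝ | 2 / 5 * (n : ℝ) ^ 2 ≤ g.eval v} :=
        fun v hv => hlow v hv.1 hv.2.le
      have := closure_minimal hsub hc
      rw [closure_Ioo hb.ne] at this
      exact this ⟨le_rfl, hb.le⟩
    · exact hlow v h h1

lemma aux_antideriv (p : Polynomial ℝ) : ∃ H : Polynomial ℝ,
    H.natDegree ≤ p.natDegree + 1 ∧ Polynomial.derivative H = p := by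
  refine ⟨∑ i ∈ Finset.range (p.natDegree + 1),
    Polynomial.C (p.coeff i / (i + 1)) * Polynomial.X ^ (i + 1), ?_, ?_⟩
  · refine Polynomial.natDegree_sum_le_of_forall_le _ _ ?_
    intro i hi
    rw [Finset.mem_range] at hi
    exact (Polynomial.natDegree_C_mul_X_pow_le _ _).trans (by omega)
  · conv_rhs => rw [p.as_sum_range_C_mul_X_pow]
    rw [Polynomial.derivative_sum]
    refine Finset.sum_congr rfl fun i _ => ?_
    rw [Polynomial.derivative_C_mul_X_pow]
    have : (i : ℝ) + 1 ≠ 0 := by positivity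
    congr 2
    push_cast
    field_simp

lemma aux_step (n s : ℕ) (w : ℝ) (hw : 0 < w) (hw1 : w ≤ 1) (hn : 6 ≤ n * w) :
    ∃ H : Polynomial ℝ, H.natDegree ≤ 2 * n * (s + 1) + 1 ∧
      (∀ x y : ℝ, -2 ≤ x → x ≤ y → y ≤ 2 → H.eval x ≤ H.eval y) ∧
      0 < H.eval 2 - H.eval (-2) ∧
      (H.eval 2 - H.eval w) + (H.eval (-w) - H.eval (-2)) ≤
        Real.exp (-s) * (H.eval 2 - H.eval (-2)) := by
  have hn0 : (0 : ℝ) < n := by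
    by_contra h
    nlinarith [not_lt.1 h]
  have hn1 : 1 ≤ n := by exact_mod_cast hn0
  obtain ⟨g, hgd, hg0, hg2, hgl⟩ := aux_fejer n hn1
  set G : Polynomial ℝ := g.comp (Polynomial.C (1 / 2) * Polynomial.X ^ 2) with hG
  have hGev : ∀ u : ℝ, G.eval u = g.eval (u ^ 2 / 2) := by
    intro u; simp only [hG, Polynomial.eval_comp, Polynomial.eval_mul, Polynomial.eval_C,
      Polynomial.eval_pow, Polynomial.eval_X]; congr 1; ring
  have hGd : (G ^ (s + 1)).natDegree ≤ 2 * n * (s + 1) := by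
    refine Polynomial.natDegree_pow_le.trans ?_
    have : G.natDegree ≤ n * 2 :=
      Polynomial.natDegree_comp_le.trans
        (Nat.mul_le_mul hgd (Polynomial.natDegree_C_mul_X_pow_le _ _))
    nlinarith
  obtain ⟨H, hHd, hH⟩ := aux_antideriv (G ^ (s + 1))
  have hder : ∀ u : ℝ, HasDerivAt (fun x => H.eval x) (G.eval u ^ (s + 1)) u := by
    intro u
    have := H.hasDerivAt u
    rwa [hH, Polynomial.eval_pow] at this
  have hlow : ∀ u : ℝ, -(2 / n) ≤ u → u ≤ 2 / n → 2 / 5 * (n : ℝ) ^ 2 ≤ G.eval u := by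
    intro u h1 h2
    rw [hGev]
    apply hgl _ (by positivity)
    have : u ^ 2 ≤ (2 / n) ^ 2 := sq_le_sq' h1 h2
    rw [div_pow] at this
    have h3 : (2 : ℝ) ^ 2 / (n : ℝ) ^ 2 = 2 * (2 / (n : ℝ) ^ 2) := by ring
    linarith
  have hnn : ∀ u : ℝ, -2 ≤ u → u ≤ 2 → 0 ≤ G.eval u := by
    intro u h1 h2
    by_cases hu : u = 0
    · exact le_trans (by positivity) (hlow u (by rw [hu, neg_nonpos]; positivity) (by rw [hu]; positivity))
    · rw [hGev]
      have : 0 < u ^ 2 := by positivity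
      exact hg0 _ (by positivity) (by nlinarith)
  have hup : ∀ u : ℝ, u ≠ 0 → -2 ≤ u → u ≤ 2 → G.eval u ≤ 4 / u ^ 2 := by
    intro u hu h1 h2
    have : 0 < u ^ 2 := by positivity
    rw [hGev]
    refine (hg2 _ (by positivity) (by nlinarith)).trans (le_of_eq ?_)
    field_simp; norm_num
  have hcont : Continuous (fun x => H.eval x) := H.continuous
  have hmono : MonotoneOn (fun x => H.eval x) (Set.Icc (-2) 2) := by
    refine monotoneOn_of_hasDerivWithinAt_nonneg (convex_Icc _ _) hcont.continuousOn
      (fun x _ => (hder x).hasDerivWithinAt) ?_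
    intro x hx
    rw [interior_Icc] at hx
    exact pow_nonneg (hnn x hx.1.le hx.2.le) _
  have hm : ∀ x y : ℝ, -2 ≤ x → x ≤ y → y ≤ 2 → H.eval x ≤ H.eval y :=
    fun x y h1 h2 h3 => hmono ⟨h1, h2.trans h3⟩ ⟨h1.trans h2, h3⟩ h2
  have h2n : 2 / (n : ℝ) ≤ w := by rw [div_le_iff₀ hn0]; linarith
  have h2n0 : 0 < 2 / (n : ℝ) := by positivity
  set B : ℝ := 2 / 5 * (n : ℝ) ^ 2 with hB
  have hB0 : 0 < B := by positivity
  -- centre mass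
  have hcent : B ^ (s + 1) * (4 / n) ≤ H.eval (2 / (n : ℝ)) - H.eval (-(2 / (n : ℝ))) := by
    have := (convex_Icc (-(2 / (n : ℝ))) (2 / n)).mul_sub_le_image_sub_of_le_deriv
      (f := fun x => H.eval x) hcont.continuousOn
      (fun x _ => (hder x).differentiableAt.differentiableWithinAt) (C := B ^ (s + 1))
      (by
        intro x hx
        rw [interior_Icc] at hx
        rw [(hder x).deriv]
        exact pow_le_pow_left₀ hB0.le (hlow x hx.1.le hx.2.le) _)
      (-(2 / n)) ⟨le_rfl, by linarith⟩ (2 / n) ⟨by linarith, le_rfl⟩ (by linarith)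
    have h3 : 2 / (n : ℝ) - -(2 / n) = 4 / n := by ring
    rwa [h3] at this
  have hM : B ^ (s + 1) * (4 / n) ≤ H.eval 2 - H.eval (-2) := by
    have h1 := hm (-2) (-(2 / n)) le_rfl (by linarith) (by linarith)
    have h2 := hm (2 / n) 2 (by linarith) (by linarith) le_rfl
    linarith
  set D : ℝ := (4 / w ^ 2) ^ s * 4 with hD
  have hD0 : 0 < D := by positivity
  have hKup : ∀ u : ℝ, w ^ 2 ≤ u ^ 2 → -2 ≤ u → u ≤ 2 → G.eval u ^ (s + 1) ≤ D / u ^ 2 := by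
    intro u h0 h1 h2
    have hu2 : 0 < u ^ 2 := lt_of_lt_of_le (by positivity) h0
    have hu : u ≠ 0 := by rintro rfl; simp at hu2
    have h3 := hup u hu h1 h2
    have h4 : G.eval u ≤ 4 / w ^ 2 := h3.trans (by gcongr)
    have h5 := hnn u h1 h2
    rw [pow_succ, hD, mul_div_assoc]
    gcongr
  have hd2 : ∀ u : ℝ, u ≠ 0 →
      HasDerivAt (fun x => H.eval x + D * x⁻¹) (G.eval u ^ (s + 1) + D * (-(u ^ 2)⁻¹)) u :=
    fun u hu => (hder u).add ((hasDerivAt_inv hu).const_mul D)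
  have htail1 : H.eval 2 - H.eval w ≤ D / w := by
    have : AntitoneOn (fun x => H.eval x + D * x⁻¹) (Set.Icc w 2) := by
      refine antitoneOn_of_hasDerivWithinAt_nonpos (convex_Icc _ _)
        (fun x hx => (hd2 x (by linarith [hx.1] : (0:ℝ) < x).ne').continuousAt.continuousWithinAt)
        (fun x hx => (hd2 x ?_).hasDerivWithinAt) ?_
      · rw [interior_Icc] at hx
        exact (by linarith [hx.1] : (0:ℝ) < x).ne'
      · intro x hx
        rw [interior_Icc] at hx
        have := hKup x (by nlinarith [hx.1]) (by linarith [hx.1]) hx.2.le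
        rw [div_eq_mul_inv] at this
        linarith
    have h := this ⟨le_rfl, by linarith⟩ ⟨by linarith, le_rfl⟩ (by linarith : w ≤ 2)
    simp only at h
    rw [div_eq_mul_inv]
    linarith
  have htail2 : H.eval (-w) - H.eval (-2) ≤ D / w := by
    have : AntitoneOn (fun x => H.eval x + D * x⁻¹) (Set.Icc (-2) (-w)) := by
      refine antitoneOn_of_hasDerivWithinAt_nonpos (convex_Icc _ _)
        (fun x hx => (hd2 x (by linarith [hx.2] : x < (0:ℝ)).ne).continuousAt.continuousWithinAt)
        (fun x hx => (hd2 x ?_).hasDerivWithinAt) ?_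
      · rw [interior_Icc] at hx
        exact (by linarith [hx.2] : x < (0:ℝ)).ne
      · intro x hx
        rw [interior_Icc] at hx
        have := hKup x (by nlinarith [hx.2]) hx.1.le (by linarith [hx.2])
        rw [div_eq_mul_inv] at this
        linarith
    have h := this ⟨le_rfl, by linarith⟩ ⟨by linarith, le_rfl⟩ (by linarith : -2 ≤ -w)
    simp only [inv_neg] at h
    rw [div_eq_mul_inv]
    linarith
  refine ⟨H, hHd.trans (by omega), hm, lt_of_lt_of_le (by positivity) hM, ?_⟩
  have hfin : 2 * (D / w) ≤ Real.exp (-s) * (B ^ (s + 1) * (4 / n)) := by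
    have he : Real.exp (-(s : ℝ)) = Real.exp (-1) ^ s := by
      rw [← Real.exp_nat_mul]; congr 1; ring
    have h1 : 4 / w ^ 2 ≤ Real.exp (-1) * B := by
      have h2 : (1 / 3 : ℝ) ≤ Real.exp (-1) := by
        rw [Real.exp_neg, one_div]
        exact inv_anti₀ (Real.exp_pos _) (by linarith [Real.exp_one_lt_d9])
      have h3 : 4 / w ^ 2 ≤ 1 / 3 * B := by
        rw [div_le_iff₀ (by positivity), hB]
        nlinarith
      exact h3.trans (by gcongr)
    have h4 : (4 / w ^ 2) ^ s ≤ (Real.exp (-1) * B) ^ s := by gcongr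
    have h5 : 8 / w ≤ B * (4 / n) := by
      have : B * (4 / n) = 8 / 5 * n := by rw [hB]; field_simp; norm_num
      rw [this, div_le_iff₀ hw]; nlinarith
    calc 2 * (D / w) = (4 / w ^ 2) ^ s * (8 / w) := by rw [hD]; ring
      _ ≤ (Real.exp (-1) * B) ^ s * (B * (4 / n)) := by gcongr
      _ = _ := by rw [he, mul_pow, pow_succ]; ring
  have := mul_le_mul_of_nonneg_left hM (Real.exp_pos (-(s:ℝ))).le
  linarith

/-- Uniform singular value amplification: there is a constant `C > 0` such that for every
`γ > 1` and `0 < δ, ε < 1/2` there is a real polynomial `P` of degree at most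
`C·(γ/δ)·log(γ/ε)` with `|P(x)| ≤ 1` on `[-1,1]` and `|P(x) - γ·x| ≤ ε·γ·x` for
`x ∈ [0, (1-δ)/γ]`. -/
theorem stmt_13 :
    ∃ C : ℝ, 0 < C ∧ ∀ γ δ ε : ℝ, 1 < γ → 0 < δ → δ < 1 / 2 → 0 < ε → ε < 1 / 2 →
      ∃ P : Polynomial ℝ, (P.natDegree : ℝ) ≤ C * (γ / δ) * Real.log (γ / ε) ∧
        (∀ x ∈ Set.Icc (-1 : ℝ) 1, |P.eval x| ≤ 1) ∧
        (∀ x ∈ Set.Icc (0 : ℝ) ((1 - δ) / γ), |P.eval x - γ * x| ≤ ε * γ * x) := by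
  refine ⟨200, by norm_num, ?_⟩
  intro γ δ ε hγ hδ hδ2 hε hε2
  have hγ0 : 0 < γ := by linarith
  set L := Real.log (γ / ε) with hL
  set q := γ / δ with hq
  have hq2 : 2 ≤ q := by rw [hq, le_div_iff₀ hδ]; linarith
  have hL2 : 1 / 2 ≤ L := by
    have h1 : (2 : ℝ) ≤ γ / ε := by rw [le_div_iff₀ hε]; linarith
    have := Real.log_le_log (by norm_num) h1
    linarith [Real.log_two_gt_d9]
  set w := δ / (2 * γ) with hw
  have hw0 : 0 < w := by positivity
  have hqw : q * w = 1 / 2 := by rw [hq, hw]; field_simp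
  set b := 1 / γ with hb
  have hb0 : 0 < b := by positivity
  have hb1 : b < 1 := by rw [hb, div_lt_one hγ0]; exact hγ
  have hγb : γ * b = 1 := by rw [hb]; field_simp
  have ha : (1 - δ) / γ = b - 2 * w := by rw [hb, hw]; field_simp
  have hw4 : 4 * w ≤ b := by
    rw [hb, hw, le_div_iff₀ hγ0]; field_simp; linarith
  set n := ⌈12 * q⌉₊ with hn
  set s := ⌈L⌉₊ with hs
  have hn1 : 12 * q ≤ n := Nat.le_ceil _
  have hn2 : (n : ℝ) ≤ 12 * q + 1 := (Nat.ceil_lt_add_one (by linarith)).le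
  have hs1 : L ≤ s := Nat.le_ceil _
  have hs2 : (s : ℝ) ≤ L + 1 := (Nat.ceil_lt_add_one (by linarith)).le
  obtain ⟨H, hHd, hm, hM, ht⟩ := aux_step n s w hw0 (by linarith) (by nlinarith)
  set M := H.eval 2 - H.eval (-2) with hMdef
  have hη : Real.exp (-s) ≤ ε / γ := by
    have : Real.exp (-(s : ℝ)) ≤ Real.exp (-L) := Real.exp_le_exp.2 (by linarith)
    rwa [Real.exp_neg L, hL, Real.exp_log (by positivity), inv_div] at this
  have ht' : (H.eval 2 - H.eval w) + (H.eval (-w) - H.eval (-2)) ≤ ε / γ * M :=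
    ht.trans (by gcongr)
  set c := b - w with hc
  set Q : Polynomial ℝ := Polynomial.C (1 / M) *
    (H.comp (Polynomial.X + Polynomial.C c) - H.comp (Polynomial.X + Polynomial.C (-c))) with hQ
  have hQev : ∀ x : ℝ, Q.eval x = (H.eval (x + c) - H.eval (x - c)) / M := by
    intro x; simp [hQ, sub_eq_add_neg]; ring
  have hQ0 : ∀ x : ℝ, -1 ≤ x → x ≤ 1 → 0 ≤ Q.eval x := by
    intro x h1 h2
    rw [hQev]
    apply div_nonneg _ hM.le
    linarith [hm (x - c) (x + c) (by linarith) (by linarith) (by linarith)]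
  have hQ1 : ∀ x : ℝ, -1 ≤ x → x ≤ 1 → Q.eval x ≤ 1 := by
    intro x h1 h2
    rw [hQev, div_le_one hM]
    linarith [hm (-2) (x - c) (by linarith) (by linarith) (by linarith),
      hm (x + c) 2 (by linarith) (by linarith) (by linarith)]
  have hQin : ∀ x : ℝ, 0 ≤ x → x ≤ b - 2 * w → 1 - Q.eval x ≤ ε / γ := by
    intro x h1 h2
    rw [hQev, one_sub_div hM.ne', div_le_iff₀ hM]
    linarith [hm (x - c) (-w) (by linarith) (by linarith) (by linarith),
      hm w (x + c) (by linarith) (by linarith) (by linarith)]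
  have hQr : ∀ x : ℝ, b ≤ x → x ≤ 1 → Q.eval x ≤ ε / γ := by
    intro x h1 h2
    rw [hQev, div_le_iff₀ hM]
    linarith [hm w (x - c) (by linarith) (by linarith) (by linarith),
      hm (x + c) 2 (by linarith) (by linarith) (by linarith),
      hm (-2) (-w) (by linarith) (by linarith) (by linarith)]
  have hQl : ∀ x : ℝ, -1 ≤ x → x ≤ -b → Q.eval x ≤ ε / γ := by
    intro x h1 h2
    rw [hQev, div_le_iff₀ hM]
    linarith [hm (x + c) (-w) (by linarith) (by linarith) (by linarith),
      hm (-2) (x - c) (by linarith) (by linarith) (by linarith),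
      hm w 2 (by linarith) (by linarith) (by linarith)]
  have hεγ : γ * (ε / γ) = ε := by field_simp
  refine ⟨Polynomial.C γ * Polynomial.X * Q, ?_, ?_, ?_⟩
  · have hcomp : ∀ d : ℝ, (H.comp (Polynomial.X + Polynomial.C d)).natDegree = H.natDegree := by
      intro d
      rw [Polynomial.natDegree_comp, Polynomial.natDegree_X_add_C, mul_one]
    have h1 : Q.natDegree ≤ H.natDegree := by
      refine (Polynomial.natDegree_C_mul_le _ _).trans ?_
      refine (Polynomial.natDegree_sub_le _ _).trans ?_
      rw [hcomp, hcomp, max_self]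
    have h2 : (Polynomial.C γ * Polynomial.X * Q).natDegree ≤ 2 * n * (s + 1) + 2 := by
      refine Polynomial.natDegree_mul_le.trans ?_
      have : (Polynomial.C γ * Polynomial.X).natDegree ≤ 1 :=
        (Polynomial.natDegree_C_mul_le _ _).trans Polynomial.natDegree_X_le
      omega
    have h3 : ((Polynomial.C γ * Polynomial.X * Q).natDegree : ℝ) ≤ 2 * n * (s + 1) + 2 := by
      exact_mod_cast h2
    have h4 : (n : ℝ) * (s + 1) ≤ (13 * q) * (5 * L) := by
      gcongr <;> linarith
    nlinarith [mul_le_mul hq2 hL2 (by norm_num) (by linarith)]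
  · intro x hx
    have h0 := hQ0 x hx.1 hx.2
    have h1 := hQ1 x hx.1 hx.2
    have hev : (Polynomial.C γ * Polynomial.X * Q).eval x = γ * x * Q.eval x := by simp
    rw [hev, abs_mul, abs_mul, abs_of_pos hγ0, abs_of_nonneg h0]
    have habs : |x| ≤ 1 := abs_le.2 hx
    by_cases hxb : |x| ≤ b
    · calc γ * |x| * Q.eval x ≤ γ * b * 1 := by gcongr
        _ = 1 := by rw [hγb, one_mul]
    · have hle : Q.eval x ≤ ε / γ := by
        rcases lt_abs.1 (not_le.1 hxb) with h | h
        · exact hQr x h.le hx.2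
        · exact hQl x hx.1 (by linarith)
      calc γ * |x| * Q.eval x ≤ γ * 1 * (ε / γ) := by gcongr
        _ = ε := by rw [mul_one, hεγ]
        _ ≤ 1 := by linarith
  · intro x hx
    rw [ha] at hx
    have hx1 : x ≤ 1 := by linarith [hx.2]
    have h1 := hQ1 x (by linarith [hx.1]) hx1
    have h2 := hQin x hx.1 hx.2
    have hev : (Polynomial.C γ * Polynomial.X * Q).eval x - γ * x = -(γ * x * (1 - Q.eval x)) := by
      simp; ring
    have hγx : 0 ≤ γ * x := mul_nonneg hγ0.le hx.1
    rw [hev, abs_neg, abs_of_nonneg (mul_nonneg hγx (by linarith))]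
    have h3 : ε / γ ≤ ε := div_le_self hε.le hγ.le
    calc γ * x * (1 - Q.eval x) ≤ γ * x * ε := by gcongr; linarith
      _ = ε * γ * x := by ring
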